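/- arXiv:1212.1634 — 2 statements merged into one kernel-verified Lean document; each statement's English description precedes it below -/
import Mathlib

section
/- Let n ≥ 1 and let O be a relatively compact open subset of the set of contracting linear cocycles of period n on ℝ² (i.e. O ⊂ GL(2,ℝ)ⁿ is open with compact closure, and every (A_i) in the closure of O is contracting). Then for every ε > 0 there exists δ > 0 with the following property: for every C¹ path t ↦ (A_{i,t})_{i∈ℤ/nℤ} from [0,∞) into O which is constant on a neighborhood of t = 0 and satisfies ‖∂A_{i,t}/∂t‖ ≤ δ/t for every t > 0 and every i, the maps f_i : ℝ² → ℝ² defined by f_i(x) := A_{i,‖x‖}(x) are C¹ diffeomorphisms of ℝ² fixing the origin, the family (f_i)_{i∈ℤ/nℤ} is a contracting diffeomorphism cocycle (every orbit of the induced map F(x,i) := (f_i(x), i+1) on ℝ² × ℤ/nℤ converges to the zero section), and ‖Df_i(x) − A_{i,‖x‖}‖ < ε for every i and every x ∈ ℝ². -/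
open Filter Topology

noncomputable section

abbrev M2 := Matrix (Fin 2) (Fin 2) ℝ
abbrev E2 := EuclideanSpace ℝ (Fin 2)

/-- The continuous linear map on Euclidean `ℝ²` induced by a `2 × 2` matrix. -/
def mCLM (A : M2) : E2 →L[ℝ] E2 := Matrix.toEuclideanCLM (𝕜 := ℝ) A

/-- Operator norm (w.r.t. the Euclidean norm) of a `2 × 2` matrix. -/
def mnorm (A : M2) : ℝ := ‖mCLM A‖

/-- Action of a `2 × 2` matrix on a vector of Euclidean `ℝ²`. -/
def mact (A : M2) (x : E2) : E2 := mCLM A x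

/-- The product `A (n-1) * ⋯ * A 0` of a cocycle over `ℤ/nℤ`. -/
def cocProd (n : ℕ) (A : ZMod n → M2) : M2 :=
  (((List.range n).map fun i => A (i : ZMod n)).reverse).prod

/-- The partial product `A (i+j-1) * ⋯ * A i` (indices mod `n`). -/
def partProd (n : ℕ) (A : ZMod n → M2) (i : ZMod n) (j : ℕ) : M2 :=
  (((List.range j).map fun l => A (i + (l : ZMod n))).reverse).prod

/-- The map induced on `ℝ² × ℤ/nℤ` by a cocycle of maps. -/
def step (n : ℕ) (f : ZMod n → E2 → E2) (p : E2 × ZMod n) : E2 × ZMod n :=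
  (f p.2 p.1, p.2 + 1)

/-- A cocycle of maps is contracting if every orbit of the induced map converges to the
zero section. -/
def IsContractingCocycle (n : ℕ) (f : ZMod n → E2 → E2) : Prop :=
  ∀ p : E2 × ZMod n, Tendsto (fun m => ((step n f)^[m] p).1) atTop (𝓝 (0 : E2))

/-- `f` is a `C¹` diffeomorphism of `ℝ²`. -/
def IsC1Diffeo (f : E2 → E2) : Prop :=
  ContDiff ℝ 1 f ∧ Function.Bijective f ∧ ContDiff ℝ 1 (Function.invFun f)

/-- A diffeomorphism cocycle over `ℤ/nℤ`: a family of `C¹` diffeomorphisms of `ℝ²`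
fixing the origin. -/
def IsDiffeoCocycle (n : ℕ) (f : ZMod n → E2 → E2) : Prop :=
  ∀ i, IsC1Diffeo (f i) ∧ f i 0 = 0

/-- `f (i+j-1) ∘ ⋯ ∘ f i`, the composition of `j` consecutive maps of the cocycle. -/
def compUpTo (n : ℕ) (f : ZMod n → E2 → E2) (i : ZMod n) : ℕ → E2 → E2
  | 0 => id
  | j + 1 => f (i + (j : ZMod n)) ∘ compUpTo n f i j

end

attribute [local instance] Matrix.normedAddCommGroup Matrix.normedSpace

section RadialMap

variable {E : Type*} [NormedAddCommGroup E] [InnerProductSpace ℝ E]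

/-- A path of operators `B` with `‖B'(t)‖ ≤ δ / t` is `δ / a`-Lipschitz on `[a, ∞)`. -/
theorem norm_sub_le_of_deriv_le {B : ℝ → E →L[ℝ] E} (hB : ContDiff ℝ 1 B) {δ : ℝ} (hδ : 0 ≤ δ)
    (hd : ∀ t, 0 < t → ‖deriv B t‖ ≤ δ / t) {a r s : ℝ} (ha : 0 < a) (hr : a ≤ r) (hs : a ≤ s) :
    ‖B s - B r‖ ≤ δ / a * |s - r| := by
  refine Convex.norm_image_sub_le_of_norm_deriv_le (s := Set.Ici a)
    (fun x _ => (hB.differentiable one_ne_zero) x) (fun x hx => ?_) (convex_Ici a) hr hs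
  have hx' : a ≤ x := hx
  exact (hd x (ha.trans_le hx')).trans (by gcongr)

/-- The radial map `x ↦ B(‖x‖) x` is linear near the origin. -/
theorem radial_eventuallyEq {B : ℝ → E →L[ℝ] E} {t₀ : ℝ} (h0 : ∀ t ≤ t₀, B t = B 0)
    {x : E} (hx : ‖x‖ < t₀) : (fun y => B ‖y‖ y) =ᶠ[𝓝 x] B ‖x‖ := by
  filter_upwards [continuous_norm.continuousAt.eventually_lt_const hx] with y hy
  rw [h0 _ hy.le, h0 _ hx.le]

theorem contDiff_radial {B : ℝ → E →L[ℝ] E} (hB : ContDiff ℝ 1 B)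
    (h0 : ∃ t₀ > 0, ∀ t ≤ t₀, B t = B 0) : ContDiff ℝ 1 fun x : E => B ‖x‖ x := by
  obtain ⟨t₀, ht₀, h0⟩ := h0
  refine contDiff_iff_contDiffAt.2 fun x => ?_
  rcases lt_or_ge ‖x‖ t₀ with hx | hx
  · exact (B ‖x‖).contDiff.contDiffAt.congr_of_eventuallyEq (radial_eventuallyEq h0 hx)
  · have hx0 : x ≠ 0 := norm_pos_iff.1 (ht₀.trans_le hx)
    exact (hB.contDiffAt.comp x (contDiffAt_norm ℝ hx0)).clm_apply contDiffAt_id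

theorem norm_fderiv_radial_sub_le {B : ℝ → E →L[ℝ] E} (hB : ContDiff ℝ 1 B)
    (h0 : ∃ t₀ > 0, ∀ t ≤ t₀, B t = B 0) {δ : ℝ} (hδ : 0 ≤ δ)
    (hd : ∀ t, 0 < t → ‖deriv B t‖ ≤ δ / t) (x : E) :
    ‖fderiv ℝ (fun y : E => B ‖y‖ y) x - B ‖x‖‖ ≤ δ := by
  obtain ⟨t₀, ht₀, h0⟩ := h0
  rcases lt_or_ge ‖x‖ t₀ with hx | hx
  · rw [(radial_eventuallyEq h0 hx).fderiv_eq, ContinuousLinearMap.fderiv]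
    simpa using hδ
  · have hx0 : 0 < ‖x‖ := ht₀.trans_le hx
    have hn : DifferentiableAt ℝ (fun y : E => ‖y‖) x :=
      (contDiffAt_norm ℝ (norm_pos_iff.1 hx0) (n := 1)).differentiableAt one_ne_zero
    have hBd : HasDerivAt B (deriv B ‖x‖) ‖x‖ := (hB.differentiable one_ne_zero _).hasDerivAt
    have h := (hBd.hasFDerivAt.comp x hn.hasFDerivAt).clm_apply (hasFDerivAt_id x)
    have he : fderiv ℝ (fun y : E => B ‖y‖ y) x = _ := h.fderiv
    rw [he]
    refine ContinuousLinearMap.opNorm_le_bound _ hδ fun v => ?_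
    have hv : |fderiv ℝ (fun y : E => ‖y‖) x v| ≤ ‖v‖ := by
      have := norm_fderiv_le_of_lipschitz ℝ (lipschitzWith_one_norm (E := E)) (x₀ := x)
      simpa using ContinuousLinearMap.le_of_opNorm_le _ this v
    have hB' : ‖deriv B ‖x‖ x‖ ≤ δ := by
      refine ((deriv B ‖x‖).le_of_opNorm_le (hd _ hx0) x).trans_eq ?_
      field_simp
    have hval : ((B ‖x‖) ∘SL ContinuousLinearMap.id ℝ E +
        ((ContinuousLinearMap.toSpanSingleton ℝ (deriv B ‖x‖)) ∘SL
          fderiv ℝ (fun y : E => ‖y‖) x).flip x - B ‖x‖) v =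
        fderiv ℝ (fun y : E => ‖y‖) x v • deriv B ‖x‖ x := by
      simp
    refine (congrArg norm hval).trans_le ?_
    rw [norm_smul, Real.norm_eq_abs, mul_comm]
    exact mul_le_mul hB' hv (abs_nonneg _) hδ

/-- If the operators `B t` expand distances by at least `c`, then the radial map expands distances
by at least `c - δ`. -/
theorem sub_mul_norm_sub_le_radial {B : ℝ → E →L[ℝ] E} (hB : ContDiff ℝ 1 B) {δ : ℝ} (hδ : 0 ≤ δ)
    (hd : ∀ t, 0 < t → ‖deriv B t‖ ≤ δ / t) {c : ℝ}
    (hc : ∀ t, 0 ≤ t → ∀ v, c * ‖v‖ ≤ ‖B t v‖) (x y : E) :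
    (c - δ) * ‖x - y‖ ≤ ‖B ‖x‖ x - B ‖y‖ y‖ := by
  wlog hxy : ‖x‖ ≤ ‖y‖ generalizing x y
  · rw [norm_sub_rev x, norm_sub_rev (B ‖x‖ x)]
    exact this y x (le_of_not_ge hxy)
  have h1 : B ‖x‖ x - B ‖y‖ y = B ‖y‖ (x - y) - (B ‖y‖ - B ‖x‖) x := by
    simp only [map_sub, _root_.sub_apply]; abel
  have h2 : ‖(B ‖y‖ - B ‖x‖) x‖ ≤ δ * ‖x - y‖ := by
    rcases eq_or_ne x 0 with rfl | hx
    · simpa using mul_nonneg hδ (norm_nonneg _)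
    have hx0 : 0 < ‖x‖ := norm_pos_iff.2 hx
    refine (ContinuousLinearMap.le_of_opNorm_le _
      (norm_sub_le_of_deriv_le hB hδ hd hx0 le_rfl hxy) x).trans ?_
    have h3 := abs_norm_sub_norm_le y x
    rw [norm_sub_rev] at h3
    calc δ / ‖x‖ * |‖y‖ - ‖x‖| * ‖x‖ = δ * |‖y‖ - ‖x‖| := by field_simp
      _ ≤ δ * ‖x - y‖ := by gcongr
  have h4 := norm_sub_norm_le (B ‖y‖ (x - y)) ((B ‖y‖ - B ‖x‖) x)
  have h5 := hc ‖y‖ (norm_nonneg _) (x - y)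
  rw [h1]
  linarith

/-- A `C¹` self-map of a finite-dimensional space with uniformly bounded derivative that expands
distances by a definite factor is a `C¹` diffeomorphism. -/
theorem bijective_and_contDiff_invFun [FiniteDimensional ℝ E] {f : E → E} (hf : ContDiff ℝ 1 f)
    {C : ℝ} (hC : ∀ x, ‖fderiv ℝ f x‖ ≤ C) {k : ℝ} (hk : 0 < k)
    (hexp : ∀ x y, k * ‖x - y‖ ≤ ‖f x - f y‖)
    (hker : ∀ x v, k * ‖v‖ ≤ ‖fderiv ℝ f x v‖) :
    Function.Bijective f ∧ ContDiff ℝ 1 (Function.invFun f) := by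
  have : CompleteSpace E := FiniteDimensional.complete ℝ E
  have hanti : AntilipschitzWith (Real.toNNReal k⁻¹) f := by
    refine AntilipschitzWith.of_le_mul_dist fun x y => ?_
    rw [Real.coe_toNNReal _ (inv_pos.2 hk).le, dist_eq_norm, dist_eq_norm, inv_mul_eq_div,
      le_div_iff₀' hk]
    exact hexp x y
  have hlip : LipschitzWith (Real.toNNReal C) f :=
    lipschitzWith_of_nnnorm_fderiv_le (hf.differentiable one_ne_zero) fun x => by
      rw [← NNReal.coe_le_coe, coe_nnnorm]
      exact (hC x).trans (Real.le_coe_toNNReal C)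
  have hinj : ∀ x, Function.Injective (fderiv ℝ f x : E →ₗ[ℝ] E) := fun x =>
    (injective_iff_map_eq_zero _).2 fun v hv => by
      have := hker x v
      rw [show fderiv ℝ f x v = 0 from hv, norm_zero] at this
      exact norm_le_zero_iff.1 (by nlinarith [norm_nonneg v])
  let e : E → E ≃L[ℝ] E := fun x =>
    (LinearEquiv.ofInjectiveEndo _ (hinj x)).toContinuousLinearEquiv
  have he : ∀ x, HasStrictFDerivAt f (e x : E →L[ℝ] E) x := fun x => by
    have h : (e x : E →L[ℝ] E) = fderiv ℝ f x := by ext v; rfl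
    rw [h]
    exact hf.contDiffAt.hasStrictFDerivAt one_ne_zero
  have hopen : IsOpenMap f := isOpenMap_of_hasStrictFDerivAt_equiv he
  have hsurj : Function.Surjective f := Set.range_eq_univ.1 <|
    IsClopen.eq_univ ⟨hanti.isClosed_range hlip.uniformContinuous, hopen.isOpen_range⟩
      (Set.range_nonempty f)
  have hbij : Function.Bijective f := ⟨hanti.injective, hsurj⟩
  refine ⟨hbij, ?_⟩
  let φ : E ≃ₜ E :=
    Equiv.toHomeomorphOfContinuousOpen (Equiv.ofBijective f hbij) hf.continuous hopen
  have hφ : Function.invFun f = φ.symm := by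
    funext y
    obtain ⟨x, rfl⟩ := hsurj y
    rw [Function.leftInverse_invFun hbij.1 x]
    exact (φ.symm_apply_apply x).symm
  rw [hφ]
  exact φ.contDiff_symm (fun x => (he x).hasFDerivAt) hf

end RadialMap

/-- A nonnegative sequence growing at most geometrically, each term of which is followed within a
bounded time by a term smaller by the factor `3 / 4`, tends to zero. -/
theorem tendsto_zero_of_recurrent_contraction {u : ℕ → ℝ} (hu : ∀ m, 0 ≤ u m) {C : ℝ} (hC : 1 ≤ C)
    (hgrow : ∀ m, u (m + 1) ≤ C * u m) {M : ℕ}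
    (hcon : ∀ m, ∃ l, 1 ≤ l ∧ l ≤ M ∧ u (m + l) ≤ 3 / 4 * u m) : Tendsto u atTop (𝓝 0) := by
  have hM : 1 ≤ M := by obtain ⟨l, h1, h2, -⟩ := hcon 0; exact h1.trans h2
  have hM' : (1 : ℝ) ≤ M := by exact_mod_cast hM
  have hpow : ∀ k s, u (s + k) ≤ C ^ k * u s := by
    intro k s
    induction k with
    | zero => simp
    | succ k ih =>
      calc u (s + k + 1) ≤ C * u (s + k) := hgrow _
        _ ≤ C * (C ^ k * u s) := by gcongr
        _ = C ^ (k + 1) * u s := by ring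
  obtain ⟨r, hr0, hr1, hrM⟩ : ∃ r : ℝ, 0 < r ∧ r < 1 ∧ 3 / 4 ≤ r ^ M := by
    have hq : 1 / (4 * (M : ℝ)) ≤ 1 / 4 := by
      rw [div_le_div_iff₀ (by positivity) (by norm_num)]; linarith
    have hq0 : 0 < 1 / (4 * (M : ℝ)) := by positivity
    refine ⟨1 + -(1 / (4 * M)), by linarith, by linarith, ?_⟩
    refine le_trans (le_of_eq ?_) (one_add_mul_le_pow (by linarith) M)
    field_simp; norm_num
  have hbound : ∀ m s, u (s + m) ≤ C ^ M * (4 / 3) * r ^ m * u s := by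
    intro m
    induction m using Nat.strong_induction_on with
    | _ m ih =>
      intro s
      rcases lt_or_ge m M with hm | hm
      · refine (hpow m s).trans (mul_le_mul_of_nonneg_right ?_ (hu s))
        have h1 : 3 / 4 ≤ r ^ m := hrM.trans (pow_le_pow_of_le_one hr0.le hr1.le hm.le)
        have h2 : C ^ m ≤ C ^ M := pow_le_pow_right₀ hC hm.le
        have h3 : 0 < C ^ M := by positivity
        nlinarith
      · obtain ⟨l, hl1, hlM, hl⟩ := hcon s
        have h1 : u (s + l) ≤ r ^ l * u s :=
          hl.trans (mul_le_mul_of_nonneg_right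
            (hrM.trans (pow_le_pow_of_le_one hr0.le hr1.le hlM)) (hu s))
        calc u (s + m) = u (s + l + (m - l)) := by congr 1; omega
          _ ≤ C ^ M * (4 / 3) * r ^ (m - l) * u (s + l) := ih _ (by omega) _
          _ ≤ C ^ M * (4 / 3) * r ^ (m - l) * (r ^ l * u s) := by gcongr
          _ = C ^ M * (4 / 3) * (r ^ (m - l) * r ^ l) * u s := by ring
          _ = C ^ M * (4 / 3) * r ^ m * u s := by
            rw [← pow_add, Nat.sub_add_cancel (hlM.trans hm)]
  have hlim : Tendsto (fun m => C ^ M * (4 / 3) * r ^ m * u 0) atTop (𝓝 0) := by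
    simpa using ((tendsto_pow_atTop_nhds_zero_of_lt_one hr0.le hr1).const_mul
      (C ^ M * (4 / 3))).mul_const (u 0)
  exact squeeze_zero hu (fun m => by simpa using hbound m 0) hlim

section OperatorCocycle

variable {n : ℕ} {E : Type*} [NormedAddCommGroup E] [NormedSpace ℝ E]

/-- The product `T (i+j-1) ∘ ⋯ ∘ T i` of `j` consecutive operators of a cocycle. -/
def opProd (T : ZMod n → E →L[ℝ] E) (i : ZMod n) : ℕ → E →L[ℝ] E
  | 0 => 1
  | j + 1 => T (i + (j : ZMod n)) * opProd T i j

theorem opProd_add (T : ZMod n → E →L[ℝ] E) (i : ZMod n) (a b : ℕ) :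
    opProd T i (a + b) = opProd T (i + (a : ZMod n)) b * opProd T i a := by
  induction b with
  | zero => simp [opProd]
  | succ b ih => rw [← add_assoc, opProd, ih, opProd, mul_assoc]; push_cast; rw [add_assoc]

theorem opProd_zero_mul (T : ZMod n → E →L[ℝ] E) (m : ℕ) :
    opProd T 0 (n * m) = opProd T 0 n ^ m := by
  induction m with
  | zero => simp [opProd]
  | succ m ih => rw [Nat.mul_succ, add_comm, opProd_add, ZMod.natCast_self, add_zero, ih, pow_succ]

theorem continuous_opProd (i : ZMod n) (j : ℕ) :
    Continuous fun T : ZMod n → E →L[ℝ] E => opProd T i j := by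
  induction j with
  | zero => exact continuous_const
  | succ j ih => exact (continuous_apply _).mul ih

/-- If the powers of the product over a period tend to zero, then the products starting at any
index become arbitrarily small. -/
theorem exists_norm_opProd_lt [NeZero n] {T : ZMod n → E →L[ℝ] E}
    (hT : Tendsto (fun m : ℕ => opProd T 0 n ^ m) atTop (𝓝 0)) (i : ZMod n) :
    ∃ l, 1 ≤ l ∧ ‖opProd T i l‖ < 1 / 2 := by
  have hi : i.val < n := ZMod.val_lt i
  have hcast : i + ((n - i.val : ℕ) : ZMod n) = 0 := by
    rw [Nat.cast_sub hi.le, ZMod.natCast_zmod_val, ZMod.natCast_self]; ring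
  have h : Tendsto (fun m => ‖opProd T i (n - i.val + n * m)‖) atTop (𝓝 0) := by
    have := (hT.mul_const (opProd T i (n - i.val))).norm
    simpa only [opProd_add, hcast, opProd_zero_mul, zero_mul, norm_zero] using this
  obtain ⟨m, hm⟩ := (h.eventually_lt_const (show (0 : ℝ) < 1 / 2 by norm_num)).exists
  exact ⟨_, by omega, hm⟩

/-- On a compact set of contracting cocycles, the contraction time is bounded. -/
theorem exists_uniform_contraction_time [NeZero n] {K : Set (ZMod n → E →L[ℝ] E)}
    (hK : IsCompact K)
    (hT : ∀ T ∈ K, Tendsto (fun m : ℕ => opProd T 0 n ^ m) atTop (𝓝 0)) :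
    ∃ M : ℕ, ∀ T ∈ K, ∀ i, ∃ l, 1 ≤ l ∧ l ≤ M ∧ ‖opProd T i l‖ < 1 / 2 := by
  let U : ℕ → Set (ZMod n → E →L[ℝ] E) := fun M =>
    ⋂ i, ⋃ l ∈ Set.Icc 1 M, {T | ‖opProd T i l‖ < 1 / 2}
  have hU : ∀ M T, T ∈ U M ↔ ∀ i, ∃ l, 1 ≤ l ∧ l ≤ M ∧ ‖opProd T i l‖ < 1 / 2 := by
    intro M T
    simp only [U, Set.mem_iInter, Set.mem_iUnion, Set.mem_Icc, Set.mem_ofPred_eq, exists_prop,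
      and_assoc]
  have hUo : ∀ M, IsOpen (U M) := fun M => isOpen_iInter_of_finite fun i =>
    isOpen_biUnion fun l _ => isOpen_lt (continuous_opProd i l).norm continuous_const
  have hmono : Monotone U := fun a b hab T h => (hU b T).2 fun i => by
    obtain ⟨l, h1, h2, h3⟩ := (hU a T).1 h i
    exact ⟨l, h1, h2.trans hab, h3⟩
  obtain ⟨M, hM⟩ := hK.elim_directed_cover U hUo (fun T hTK => by
    choose l hl1 hl using exists_norm_opProd_lt (hT T hTK)
    exact Set.mem_iUnion.2 ⟨Finset.univ.sup l, (hU _ T).2 fun i =>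
      ⟨l i, hl1 i, Finset.le_sup (Finset.mem_univ i), hl i⟩⟩) hmono.directed_le
  exact ⟨M, fun T hTK => (hU M T).1 (hM hTK)⟩

/-- On a compact set of invertible cocycles, the operators and their inverses are uniformly
bounded. -/
theorem exists_uniform_bounds [NeZero n] [FiniteDimensional ℝ E] {K : Set (ZMod n → E →L[ℝ] E)}
    (hK : IsCompact K) (hinj : ∀ T ∈ K, ∀ i, Function.Injective (T i)) :
    ∃ C : ℝ, 1 ≤ C ∧ ∃ c : ℝ, 0 < c ∧ c ≤ 1 ∧ ∀ T ∈ K, ∀ i,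
      ‖T i‖ ≤ C ∧ ∀ v, c * ‖v‖ ≤ ‖T i v‖ := by
  have : ProperSpace E := FiniteDimensional.proper ℝ E
  obtain ⟨C, hC⟩ := hK.exists_bound_of_continuousOn (continuous_id.continuousOn)
  have hc : ∀ i : ZMod n, ∃ c : ℝ, 0 < c ∧
      ∀ b ∈ K ×ˢ Metric.sphere (0 : E) 1, c ≤ ‖b.1 i b.2‖ := by
    intro i
    refine (hK.prod (isCompact_sphere 0 1)).exists_forall_le' (Continuous.continuousOn ?_) ?_
    · exact (((continuous_apply i).comp continuous_fst).clm_apply continuous_snd).norm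
    · rintro ⟨T, v⟩ ⟨hT, hv⟩
      refine norm_pos_iff.2 fun h0 => ?_
      have : v = 0 := hinj T hT i (h0.trans (map_zero _).symm)
      simp [this] at hv
  choose c hc0 hc using hc
  obtain ⟨j, -, hj⟩ := Finset.exists_min_image Finset.univ c Finset.univ_nonempty
  refine ⟨max C 1, le_max_right _ _, min (c j) 1, lt_min (hc0 j) one_pos, min_le_right _ _,
    fun T hT i => ⟨(norm_le_pi_norm T i).trans ((hC T hT).trans (le_max_left _ _)), fun v => ?_⟩⟩
  rcases eq_or_ne v 0 with rfl | hv
  · simp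
  have hv0 : 0 < ‖v‖ := norm_pos_iff.2 hv
  have h1 := hc i (T, ‖v‖⁻¹ • v) ⟨hT, by simp [norm_smul, hv0.ne']⟩
  have h2 : c j ≤ ‖T i v‖ / ‖v‖ := by
    refine (hj i (Finset.mem_univ i)).trans (h1.trans_eq ?_)
    simp [norm_smul, div_eq_inv_mul]
  exact (mul_le_mul_of_nonneg_right (min_le_left _ _) hv0.le).trans ((le_div_iff₀ hv0).1 h2)

/-- An orbit of a nonautonomous cocycle of operators `S` stays close to the orbit of the cocycle
`T` if `S k` is close to `T (i + k)`. -/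
theorem norm_sub_opProd_le {T : ZMod n → E →L[ℝ] E} {i : ZMod n} {S : ℕ → E →L[ℝ] E} {x : ℕ → E}
    (hx : ∀ k, x (k + 1) = S k (x k)) {C η : ℝ} (hC : 1 ≤ C) (hT : ∀ j, ‖T j‖ ≤ C)
    (hxC : ∀ k, ‖x k‖ ≤ C ^ k * ‖x 0‖) (hη : 0 ≤ η) {l : ℕ}
    (hST : ∀ k < l, ‖S k - T (i + (k : ZMod n))‖ ≤ η) :
    ‖x l - opProd T i l (x 0)‖ ≤ l * C ^ l * η * ‖x 0‖ := by
  induction l with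
  | zero => simp [opProd]
  | succ k ih =>
    have ih := ih fun j hj => hST j (hj.trans k.lt_succ_self)
    have h1 : x (k + 1) - opProd T i (k + 1) (x 0) =
        T (i + (k : ZMod n)) (x k - opProd T i k (x 0)) + (S k - T (i + (k : ZMod n))) (x k) := by
      rw [hx, opProd, mul_apply_eq_comp, map_sub, _root_.sub_apply]
      abel
    have h2 := (T (i + (k : ZMod n))).le_of_opNorm_le (hT _) (x k - opProd T i k (x 0))
    have h3 := (S k - T (i + (k : ZMod n))).le_of_opNorm_le (hST k k.lt_succ_self) (x k)
    have h4 : C ^ k ≤ C ^ (k + 1) := pow_le_pow_right₀ hC k.le_succ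
    calc ‖x (k + 1) - opProd T i (k + 1) (x 0)‖
        ≤ C * ‖x k - opProd T i k (x 0)‖ + η * ‖x k‖ := by
          rw [h1]; exact (norm_add_le _ _).trans (add_le_add h2 h3)
      _ ≤ C * (k * C ^ k * η * ‖x 0‖) + η * (C ^ k * ‖x 0‖) := by
          gcongr
          exact hxC k
      _ ≤ C * (k * C ^ k * η * ‖x 0‖) + η * (C ^ (k + 1) * ‖x 0‖) := by gcongr
      _ = ((k + 1 : ℕ) : ℝ) * C ^ (k + 1) * η * ‖x 0‖ := by push_cast; ring


end OperatorCocycle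

/-- Orbits of the radial cocycle of a slowly varying path of contracting cocycles tend to zero. -/
theorem tendsto_radial_orbit {n : ℕ} {E : Type*} [NormedAddCommGroup E] [InnerProductSpace ℝ E]
    {B : ℝ → ZMod n → E →L[ℝ] E} (hB : ∀ i, ContDiff ℝ 1 fun t => B t i) {δ : ℝ} (hδ : 0 ≤ δ)
    (hd : ∀ i t, 0 < t → ‖deriv (fun s => B s i) t‖ ≤ δ / t) {C c : ℝ} (hC : 1 ≤ C) (hc : 0 < c)
    (hc1 : c ≤ 1) (hBC : ∀ t, 0 ≤ t → ∀ i, ‖B t i‖ ≤ C)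
    (hBc : ∀ t, 0 ≤ t → ∀ i v, c * ‖v‖ ≤ ‖B t i v‖) {M : ℕ}
    (hM : ∀ t, 0 ≤ t → ∀ i, ∃ l, 1 ≤ l ∧ l ≤ M ∧ ‖opProd (B t) i l‖ < 1 / 2)
    (hδM : M * C ^ M * (δ / c ^ M * C ^ M) ≤ 1 / 4) {x : ℕ → E} {i : ZMod n}
    (hx : ∀ k, x (k + 1) = B ‖x k‖ (i + (k : ZMod n)) (x k)) : Tendsto x atTop (𝓝 0) := by
  have hgrow : ∀ k, ‖x (k + 1)‖ ≤ C * ‖x k‖ := fun k => by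
    rw [hx]
    exact ContinuousLinearMap.le_of_opNorm_le _ (hBC _ (norm_nonneg _) _) _
  rw [tendsto_zero_iff_norm_tendsto_zero]
  refine tendsto_zero_of_recurrent_contraction (fun _ => norm_nonneg _) hC hgrow (M := M)
    fun s => ?_
  obtain ⟨l, hl1, hlM, hl⟩ := hM ‖x s‖ (norm_nonneg _) (i + (s : ZMod n))
  refine ⟨l, hl1, hlM, ?_⟩
  have hup : ∀ k, ‖x (s + k)‖ ≤ C ^ k * ‖x s‖ := fun k => by
    induction k with
    | zero => simp
    | succ k ih =>
      calc ‖x (s + k + 1)‖ ≤ C * ‖x (s + k)‖ := hgrow _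
        _ ≤ C * (C ^ k * ‖x s‖) := by gcongr
        _ = C ^ (k + 1) * ‖x s‖ := by ring
  have hlow : ∀ k, c ^ k * ‖x s‖ ≤ ‖x (s + k)‖ := fun k => by
    induction k with
    | zero => simp
    | succ k ih =>
      calc c ^ (k + 1) * ‖x s‖ = c * (c ^ k * ‖x s‖) := by ring
        _ ≤ c * ‖x (s + k)‖ := by gcongr
        _ ≤ ‖x (s + k + 1)‖ := by rw [hx]; exact hBc _ (norm_nonneg _) _ _
  rcases (norm_nonneg (x s)).eq_or_lt with h0 | h0
  · have := hup l
    rw [← h0, mul_zero] at this ⊢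
    simpa using this
  have hcM : 0 < c ^ M := by positivity
  have hη : 0 ≤ δ / c ^ M * C ^ M := by positivity
  have hclose : ∀ k < l, ‖B ‖x (s + k)‖ (i + ((s + k : ℕ) : ZMod n)) -
      B ‖x s‖ (i + (s : ZMod n) + (k : ZMod n))‖ ≤ δ / c ^ M * C ^ M := by
    intro k hk
    have hkM : k ≤ M := hk.le.trans hlM
    have h1 : c ^ M * ‖x s‖ ≤ ‖x (s + k)‖ :=
      (mul_le_mul_of_nonneg_right (pow_le_pow_of_le_one hc.le hc1 hkM) h0.le).trans (hlow k)
    have h2 : ‖x (s + k)‖ ≤ C ^ M * ‖x s‖ :=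
      (hup k).trans (mul_le_mul_of_nonneg_right (pow_le_pow_right₀ hC hkM) h0.le)
    have h3 : c ^ M * ‖x s‖ ≤ ‖x s‖ := mul_le_of_le_one_left h0.le (pow_le_one₀ hc.le hc1)
    have h4 : ‖x s‖ ≤ C ^ M * ‖x s‖ := le_mul_of_one_le_left h0.le (one_le_pow₀ hC)
    have h5 : |‖x (s + k)‖ - ‖x s‖| ≤ C ^ M * ‖x s‖ :=
      abs_sub_le_iff.2 ⟨by linarith, by linarith [norm_nonneg (x (s + k))]⟩
    rw [Nat.cast_add, ← add_assoc]
    refine (norm_sub_le_of_deriv_le (hB _) hδ (hd _) (mul_pos hcM h0) h3 h1).trans ?_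
    calc δ / (c ^ M * ‖x s‖) * |‖x (s + k)‖ - ‖x s‖|
        ≤ δ / (c ^ M * ‖x s‖) * (C ^ M * ‖x s‖) := by gcongr
      _ = δ / c ^ M * C ^ M := by field_simp
  have h1 := norm_sub_opProd_le (T := B ‖x s‖) (i := i + (s : ZMod n)) (x := fun k => x (s + k))
    (S := fun k => B ‖x (s + k)‖ (i + ((s + k : ℕ) : ZMod n))) (fun k => hx (s + k)) hC
    (hBC _ (norm_nonneg _)) hup hη hclose
  simp only [add_zero] at h1
  have h2 : ‖opProd (B ‖x s‖) (i + (s : ZMod n)) l (x s)‖ ≤ 1 / 2 * ‖x s‖ :=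
    ContinuousLinearMap.le_of_opNorm_le _ hl.le _
  have h3 : l * C ^ l * (δ / c ^ M * C ^ M) ≤ 1 / 4 := by
    refine le_trans ?_ hδM
    gcongr
  have h4 := mul_le_mul_of_nonneg_right h3 h0.le
  have h5 := norm_le_norm_add_norm_sub' (x (s + l)) (opProd (B ‖x s‖) (i + (s : ZMod n)) l (x s))
  linarith

theorem continuous_mCLM : Continuous mCLM :=
  LinearMap.continuous_of_finiteDimensional
    (Matrix.toEuclideanCLM (n := Fin 2) (𝕜 := ℝ)).toAlgEquiv.toLinearMap

theorem hasDerivAt_mCLM {A : ℝ → M2} {A' : M2} {t : ℝ} (h : HasDerivAt A A' t) :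
    HasDerivAt (fun s => mCLM (A s)) (mCLM A') t :=
  let L : M2 →L[ℝ] E2 →L[ℝ] E2 :=
    ⟨(Matrix.toEuclideanCLM (n := Fin 2) (𝕜 := ℝ)).toAlgEquiv.toLinearMap, continuous_mCLM⟩
  L.hasFDerivAt.comp_hasDerivAt t h

theorem contDiff_mCLM {A : ℝ → M2} (h : ContDiff ℝ 1 A) : ContDiff ℝ 1 fun s => mCLM (A s) :=
  let L : M2 →L[ℝ] E2 →L[ℝ] E2 :=
    ⟨(Matrix.toEuclideanCLM (n := Fin 2) (𝕜 := ℝ)).toAlgEquiv.toLinearMap, continuous_mCLM⟩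
  L.contDiff.comp h

theorem mCLM_mul (A B : M2) : mCLM (A * B) = mCLM A * mCLM B :=
  map_mul (Matrix.toEuclideanCLM (n := Fin 2) (𝕜 := ℝ)) A B

theorem mCLM_pow (A : M2) (m : ℕ) : mCLM (A ^ m) = mCLM A ^ m :=
  map_pow (Matrix.toEuclideanCLM (n := Fin 2) (𝕜 := ℝ)) A m

theorem mCLM_zero : mCLM 0 = 0 := map_zero (Matrix.toEuclideanCLM (n := Fin 2) (𝕜 := ℝ))

theorem mCLM_one : mCLM 1 = 1 := map_one (Matrix.toEuclideanCLM (n := Fin 2) (𝕜 := ℝ))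

theorem injective_mCLM {A : M2} (hA : IsUnit A) : Function.Injective (mCLM A) := by
  obtain ⟨u, rfl⟩ := hA
  refine Function.LeftInverse.injective (g := mCLM (↑u⁻¹ : M2)) fun v => ?_
  rw [← mul_apply_eq_comp, ← mCLM_mul, Units.inv_mul, mCLM_one]
  rfl

theorem mCLM_cocProd (n : ℕ) (A : ZMod n → M2) :
    mCLM (cocProd n A) = opProd (fun i => mCLM (A i)) 0 n := by
  have h : ∀ m : ℕ, mCLM (((List.range m).map fun i : ℕ => A (i : ZMod n)).reverse).prod =
      opProd (fun i => mCLM (A i)) 0 m := by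
    intro m
    induction m with
    | zero => simpa [opProd] using mCLM_one
    | succ m ih =>
      rw [List.range_succ, List.map_append, List.reverse_append, List.prod_append, mCLM_mul, ih]
      simp [opProd]
  have hA : cocProd n A = (((List.range n).map fun i : ℕ => A (i : ZMod n)).reverse).prod := by
    simp [cocProd, ← List.map_eq_flatMap, Function.comp_def]
  rw [hA, h]

/-- Realization of slowly-varying paths of contracting linear cocycles as
contracting diffeomorphism cocycles. -/
theorem stmt0 (n : ℕ) (hn : 1 ≤ n) (O : Set (ZMod n → M2))
    (hOopen : IsOpen O) (hOcpt : IsCompact (closure O))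
    (hOcon : ∀ A ∈ closure O, (∀ i, IsUnit (A i)) ∧
      Filter.Tendsto (fun m : ℕ => cocProd n A ^ m) Filter.atTop (nhds (0 : M2)))
    (ε : ℝ) (hε : 0 < ε) :
    ∃ δ > 0, ∀ A : ℝ → ZMod n → M2,
      (∀ i, ContDiff ℝ 1 fun t => A t i) →
      (∀ t : ℝ, 0 ≤ t → A t ∈ O) →
      (∃ t₀ > 0, ∀ t ≤ t₀, A t = A 0) →
      (∀ (i : ZMod n) (t : ℝ), 0 < t → mnorm (deriv (fun s => A s i) t) ≤ δ / t) →
      IsDiffeoCocycle n (fun i x => mact (A ‖x‖ i) x) ∧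
      IsContractingCocycle n (fun i x => mact (A ‖x‖ i) x) ∧
      ∀ (i : ZMod n) (x : E2),
        ‖fderiv ℝ (fun y : E2 => mact (A ‖y‖ i) y) x - mCLM (A ‖x‖ i)‖ < ε := by
  
  have : NeZero n := ⟨by omega⟩
  let Φ : (ZMod n → M2) → ZMod n → E2 →L[ℝ] E2 := fun A i => mCLM (A i)
  have hΦ : Continuous Φ := continuous_pi fun i => continuous_mCLM.comp (continuous_apply i)
  have hK : IsCompact (Φ '' closure O) := hOcpt.image hΦ
  obtain ⟨C, hC, c, hc, hc1, hCc⟩ := exists_uniform_bounds hK <| by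
    rintro _ ⟨A, hA, rfl⟩ i
    exact injective_mCLM ((hOcon A hA).1 i)
  obtain ⟨M, hM⟩ := exists_uniform_contraction_time hK <| by
    rintro _ ⟨A, hA, rfl⟩
    have h := (continuous_mCLM.tendsto 0).comp (hOcon A hA).2
    simpa only [Function.comp_def, mCLM_pow, mCLM_zero, mCLM_cocProd] using h
  let δ : ℝ := min (ε / 2) (min (c / 2) (c ^ M / (4 * (M + 1) * C ^ M * C ^ M)))
  have hδ : 0 < δ := by positivity
  have hδε : δ < ε := (min_le_left _ _).trans_lt (half_lt_self hε)
  have hδc : δ < c := ((min_le_right _ _).trans (min_le_left _ _)).trans_lt (half_lt_self hc)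
  have hδM : M * C ^ M * (δ / c ^ M * C ^ M) ≤ 1 / 4 := by
    have h : δ ≤ c ^ M / (4 * (M + 1) * C ^ M * C ^ M) :=
      (min_le_right _ _).trans (min_le_right _ _)
    calc M * C ^ M * (δ / c ^ M * C ^ M)
        ≤ (M + 1) * C ^ M * (c ^ M / (4 * (M + 1) * C ^ M * C ^ M) / c ^ M * C ^ M) := by
          gcongr
          linarith
      _ = 1 / 4 := by field_simp
  refine ⟨δ, hδ, fun A hA hAO hA0 hd => ?_⟩
  have hΦK : ∀ t, 0 ≤ t → Φ (A t) ∈ Φ '' closure O := fun t ht =>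
    Set.mem_image_of_mem Φ (subset_closure (hAO t ht))
  have hB : ∀ i, ContDiff ℝ 1 fun t => mCLM (A t i) := fun i => contDiff_mCLM (hA i)
  have hBd : ∀ i t, 0 < t → ‖deriv (fun s => mCLM (A s i)) t‖ ≤ δ / t := fun i t ht => by
    rw [(hasDerivAt_mCLM ((hA i).differentiable one_ne_zero t).hasDerivAt).deriv]
    exact hd i t ht
  have hB0 : ∀ i, ∃ t₀ > 0, ∀ t ≤ t₀, mCLM (A t i) = mCLM (A 0 i) := fun i => by
    obtain ⟨t₀, ht₀, h⟩ := hA0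
    exact ⟨t₀, ht₀, fun t ht => by rw [h t ht]⟩
  have hnear : ∀ i x, ‖fderiv ℝ (fun y : E2 => mact (A ‖y‖ i) y) x - mCLM (A ‖x‖ i)‖ ≤ δ :=
    fun i x => norm_fderiv_radial_sub_le (hB i) (hB0 i) hδ.le (hBd i) x
  have hlow : ∀ t, 0 ≤ t → ∀ i v, c * ‖v‖ ≤ ‖mCLM (A t i) v‖ := fun t ht i =>
    (hCc _ (hΦK t ht) i).2
  have hup : ∀ t, 0 ≤ t → ∀ i, ‖mCLM (A t i)‖ ≤ C := fun t ht i => (hCc _ (hΦK t ht) i).1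
  refine ⟨fun i => ⟨?_, map_zero _⟩, fun p => ?_, fun i x => (hnear i x).trans_lt hδε⟩
  · have hf : ContDiff ℝ 1 fun x : E2 => mact (A ‖x‖ i) x := contDiff_radial (hB i) (hB0 i)
    refine ⟨hf, bijective_and_contDiff_invFun hf (C := C + δ) (fun x => ?_) (sub_pos.2 hδc)
      (sub_mul_norm_sub_le_radial (hB i) hδ.le (hBd i) fun t ht => hlow t ht i) fun x v => ?_⟩
    · exact (norm_le_norm_add_norm_sub' _ _).trans
        (add_le_add (hup _ (norm_nonneg x) i) (hnear i x))
    · have h1 := ContinuousLinearMap.le_of_opNorm_le _ (hnear i x) v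
      have h2 := hlow _ (norm_nonneg x) i v
      rw [_root_.sub_apply, norm_sub_rev] at h1
      have h3 := norm_le_norm_add_norm_sub' (mCLM (A ‖x‖ i) v)
        (fderiv ℝ (fun y : E2 => mact (A ‖y‖ i) y) x v)
      linarith
  · have hsnd : ∀ m, ((step n fun i x => mact (A ‖x‖ i) x)^[m] p).2 = p.2 + (m : ZMod n) := by
      intro m
      induction m with
      | zero => simp
      | succ m ih => rw [Function.iterate_succ_apply', step, ih]; push_cast; ring
    refine tendsto_radial_orbit (B := fun t i => mCLM (A t i)) (i := p.2) hB hδ.le hBd hC hc hc1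
      hup hlow (fun t ht => hM _ (hΦK t ht)) hδM fun k => ?_
    rw [Function.iterate_succ_apply', ← hsnd]
    rfl
end

section
/- Given K ≥ 1, ε > 0 and an integer k ≥ 1, there exists δ > 0 such that the following holds. Let n ≥ 1 and let t ↦ (A_{i,t})_{i∈ℤ/nℤ} be a C¹ path from [0,∞) into GL(2,ℝ)ⁿ, constant on a neighborhood of t = 0, satisfying for all i and all t ≥ 0: (1) ‖A_{i,t}‖ < K and ‖A_{i,t}⁻¹‖ < K; (2) ‖A_{i+k−1,t}···A_{i,t}‖ < 1/2 (indices mod n); (3) ‖∂A_{i,t}/∂t‖ ≤ δ/t for t > 0. Then the maps f_i : ℝ² → ℝ² defined by f_i(x) := A_{i,‖x‖}(x) are C¹ diffeomorphisms fixing the origin, the cocycle (f_i)_{i∈ℤ/nℤ} is contracting (every orbit of the induced map F(x,i) := (f_i(x), i+1) on ℝ² × ℤ/nℤ converges to the zero section), and for every x ∈ ℝ², every i ∈ ℤ/nℤ and every 0 ≤ j ≤ k−1, ‖D(f_{i+j−1}∘···∘f_i)(x) − A_{i+j−1,‖x‖}···A_{i,‖x‖}‖ < ε. -/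
open Filter Topology

/-- A `C¹` path of operators, constant near `0`, uniformly bounded with uniformly bounded inverses
by `K`, whose speed at time `t` is at most `δ / t`. -/
structure IsSlowPath {E : Type*} [NormedAddCommGroup E] [NormedSpace ℝ E] (K δ : ℝ)
    (B : ℝ → E →L[ℝ] E) : Prop where
  contDiff : ContDiff ℝ 1 B
  eventually_const : ∃ t₀ > 0, ∀ t ≤ t₀, B t = B 0
  norm_le : ∀ t, 0 ≤ t → ‖B t‖ ≤ K
  le_mul_norm : ∀ t, 0 ≤ t → ∀ v, ‖v‖ ≤ K * ‖B t v‖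
  norm_deriv_le : ∀ t, 0 < t → ‖deriv B t‖ ≤ δ / t

section Radial

variable {E : Type*} [NormedAddCommGroup E] [InnerProductSpace ℝ E] {K δ : ℝ} {B : ℝ → E →L[ℝ] E}

/-- The map acting on the sphere of radius `t` as the operator `B t`. -/
noncomputable def radial (B : ℝ → E →L[ℝ] E) (x : E) : E := B ‖x‖ x

theorem IsSlowPath.norm_sub_le (h : IsSlowPath K δ B) (hδ : 0 ≤ δ) {s t : ℝ} (hs : 0 < s)
    (hst : s ≤ t) : ‖B t - B s‖ ≤ δ / s * (t - s) := by
  have hd := h.contDiff.differentiable one_ne_zero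
  have := (convex_Icc s t).norm_image_sub_le_of_norm_deriv_le (f := B) (C := δ / s)
    (fun x _ => hd x) (fun x hx => (h.norm_deriv_le x (hs.trans_le hx.1)).trans
      (div_le_div_of_nonneg_left hδ hs hx.1)) (Set.left_mem_Icc.2 hst) (Set.right_mem_Icc.2 hst)
  rwa [Real.norm_of_nonneg (sub_nonneg.2 hst)] at this

theorem IsSlowPath.norm_sub_le_of_comparable (h : IsSlowPath K δ B) (hδ : 0 ≤ δ) {C s t : ℝ}
    (hC : 0 < C) (hs : 0 < s) (hst : t ≤ C * s) (hts : s ≤ C * t) :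
    ‖B t - B s‖ ≤ δ * C := by
  have ht : 0 < t := pos_of_mul_pos_right (hs.trans_le hts) hC.le
  rcases le_total s t with hle | hle
  · calc ‖B t - B s‖ ≤ δ / s * (t - s) := h.norm_sub_le hδ hs hle
      _ ≤ δ / s * (C * s) := by gcongr; linarith
      _ = δ * C := by field_simp
  · rw [norm_sub_rev]
    calc ‖B s - B t‖ ≤ δ / t * (s - t) := h.norm_sub_le hδ ht hle
      _ ≤ δ / t * (C * t) := by gcongr; linarith
      _ = δ * C := by field_simp

theorem IsSlowPath.radial_eventuallyEq (h : IsSlowPath K δ B) : radial B =ᶠ[𝓝 0] B 0 := by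
  obtain ⟨t₀, ht₀, hc⟩ := h.eventually_const
  filter_upwards [Metric.ball_mem_nhds (0 : E) ht₀] with x hx
  rw [radial, hc _ (mem_ball_zero_iff.1 hx).le]

theorem IsSlowPath.contDiff_radial (h : IsSlowPath K δ B) : ContDiff ℝ 1 (radial B) := by
  refine contDiff_iff_contDiffAt.2 fun x => ?_
  rcases eq_or_ne x 0 with rfl | hx
  · exact (B 0).contDiff.contDiffAt.congr_of_eventuallyEq h.radial_eventuallyEq
  · exact (h.contDiff.contDiffAt.comp x (contDiffAt_norm ℝ hx)).clm_apply contDiffAt_id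

theorem IsSlowPath.hasFDerivAt_radial (h : IsSlowPath K δ B) (x : E) :
    HasFDerivAt (radial B) (fderiv ℝ (radial B) x) x :=
  (h.contDiff_radial.differentiable one_ne_zero x).hasFDerivAt

theorem IsSlowPath.norm_fderiv_radial_sub_le (h : IsSlowPath K δ B) (hδ : 0 ≤ δ) (x : E) :
    ‖fderiv ℝ (radial B) x - B ‖x‖‖ ≤ δ := by
  rcases eq_or_ne x 0 with rfl | hx
  · rw [h.radial_eventuallyEq.fderiv_eq, ContinuousLinearMap.fderiv]
    simpa using hδ
  have hx' : 0 < ‖x‖ := norm_pos_iff.2 hx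
  have hn : DifferentiableAt ℝ (fun y : E => ‖y‖) x :=
    (contDiffAt_norm ℝ hx (n := 1)).differentiableAt one_ne_zero
  have hB := (h.contDiff.differentiable one_ne_zero ‖x‖).hasDerivAt.hasFDerivAt.comp x
    hn.hasFDerivAt
  have hD := (hB.clm_apply (hasFDerivAt_id x)).fderiv
  have hle : ‖fderiv ℝ (fun y : E => ‖y‖) x‖ ≤ 1 := by
    simpa using norm_fderiv_le_of_lipschitz ℝ (lipschitzWith_one_norm (E := E)) (x₀ := x)
  refine ContinuousLinearMap.opNorm_le_bound _ hδ fun v => ?_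
  have : (fderiv ℝ (radial B) x - B ‖x‖) v
      = (fderiv ℝ (fun y : E => ‖y‖) x v) • deriv B ‖x‖ x := by
    change (fderiv ℝ (fun y : E => (B ∘ norm) y (id y)) x - B ‖x‖) v = _
    rw [hD]
    simp
  rw [this, norm_smul]
  calc ‖fderiv ℝ (fun y : E => ‖y‖) x v‖ * ‖deriv B ‖x‖ x‖
      ≤ (1 * ‖v‖) * (δ / ‖x‖ * ‖x‖) := by
        gcongr
        · exact ContinuousLinearMap.le_of_opNorm_le _ hle v
        · exact ContinuousLinearMap.le_of_opNorm_le _ (h.norm_deriv_le _ hx') x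
    _ = δ * ‖v‖ := by field_simp

theorem IsSlowPath.norm_radial_le (h : IsSlowPath K δ B) (x : E) : ‖radial B x‖ ≤ K * ‖x‖ :=
  ContinuousLinearMap.le_of_opNorm_le _ (h.norm_le _ (norm_nonneg x)) x

theorem IsSlowPath.norm_le_mul_norm_radial (h : IsSlowPath K δ B) (x : E) :
    ‖x‖ ≤ K * ‖radial B x‖ :=
  h.le_mul_norm _ (norm_nonneg x) x

theorem IsSlowPath.norm_sub_le_mul_radial (h : IsSlowPath K δ B) (hδ : 0 ≤ δ) (hK : 0 ≤ K)
    (x y : E) : (1 - K * δ) * ‖x - y‖ ≤ K * ‖radial B x - radial B y‖ := by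
  wlog hxy : ‖y‖ ≤ ‖x‖ generalizing x y
  · rw [norm_sub_rev x, norm_sub_rev (radial B x)]
    exact this y x (le_of_not_ge hxy)
  have hsmall : ‖(B ‖x‖ - B ‖y‖) y‖ ≤ δ * ‖x - y‖ := by
    rcases eq_or_ne y 0 with rfl | hy
    · simpa using mul_nonneg hδ (norm_nonneg x)
    have hy' : 0 < ‖y‖ := norm_pos_iff.2 hy
    calc ‖(B ‖x‖ - B ‖y‖) y‖ ≤ δ / ‖y‖ * (‖x‖ - ‖y‖) * ‖y‖ :=
          ContinuousLinearMap.le_of_opNorm_le _ (h.norm_sub_le hδ hy' hxy) y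
      _ = δ * (‖x‖ - ‖y‖) := by field_simp
      _ ≤ δ * ‖x - y‖ := by gcongr; exact norm_sub_norm_le x y
  have hlow := h.le_mul_norm ‖x‖ (norm_nonneg x) (x - y)
  have hdec : B ‖x‖ (x - y) = (radial B x - radial B y) - (B ‖x‖ - B ‖y‖) y := by
    simp [radial]
  have htri := _root_.norm_sub_le (radial B x - radial B y) ((B ‖x‖ - B ‖y‖) y)
  rw [← hdec] at htri
  nlinarith [mul_le_mul_of_nonneg_left (htri.trans (add_le_add_right hsmall _)) hK]

theorem IsSlowPath.fderiv_radial_injective (h : IsSlowPath K δ B) (hδ : 0 ≤ δ) (hK : 0 ≤ K)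
    (hKδ : K * δ < 1) (x : E) : Function.Injective (fderiv ℝ (radial B) x) := by
  refine (injective_iff_map_eq_zero _).2 fun v hv => ?_
  have h1 := ContinuousLinearMap.le_of_opNorm_le _ (h.norm_fderiv_radial_sub_le hδ x) v
  rw [sub_apply, hv, zero_sub, norm_neg] at h1
  have h2 := h.le_mul_norm ‖x‖ (norm_nonneg x) v
  have h3 := mul_le_mul_of_nonneg_left h1 hK
  refine norm_le_zero_iff.1 ?_
  nlinarith [norm_nonneg v]

theorem IsSlowPath.bijective_radial_and_contDiff_invFun [FiniteDimensional ℝ E]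
    (h : IsSlowPath K δ B) (hδ : 0 ≤ δ) (hK : 0 < K) (hKδ : K * δ < 1) :
    Function.Bijective (radial B) ∧ ContDiff ℝ 1 (Function.invFun (radial B)) := by
  have := FiniteDimensional.complete ℝ E
  let D (x : E) : E ≃L[ℝ] E :=
    (LinearEquiv.ofInjectiveEndo (fderiv ℝ (radial B) x).toLinearMap
      (h.fderiv_radial_injective hδ hK.le hKδ x)).toContinuousLinearEquiv
  have hD (x : E) : (D x : E →L[ℝ] E) = fderiv ℝ (radial B) x := by
    ext v; rfl
  have hD' (x : E) : HasFDerivAt (radial B) (D x : E →L[ℝ] E) x := by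
    rw [hD]; exact h.hasFDerivAt_radial x
  have hopen : IsOpenMap (radial B) := isOpenMap_iff_nhds_le.2 fun x =>
    (HasStrictFDerivAt.map_nhds_eq_of_equiv (f' := D x)
      (h.contDiff_radial.contDiffAt.hasStrictFDerivAt' (hD' x) one_ne_zero)).ge
  have hpos : 0 < 1 - K * δ := by linarith
  have hanti : AntilipschitzWith (K / (1 - K * δ)).toNNReal (radial B) := by
    refine AntilipschitzWith.of_le_mul_dist fun x y => ?_
    rw [Real.coe_toNNReal _ (by positivity), dist_eq_norm, dist_eq_norm, div_mul_eq_mul_div,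
      le_div_iff₀ hpos, mul_comm]
    exact h.norm_sub_le_mul_radial hδ hK.le x y
  have hlip : LipschitzWith (K + δ).toNNReal (radial B) := by
    refine lipschitzWith_of_nnnorm_fderiv_le (𝕜 := ℝ)
      (h.contDiff_radial.differentiable one_ne_zero) fun x => ?_
    rw [← NNReal.coe_le_coe, coe_nnnorm, Real.coe_toNNReal _ (by positivity)]
    have := norm_le_norm_add_norm_sub' (fderiv ℝ (radial B) x) (B ‖x‖)
    linarith [h.norm_le _ (norm_nonneg x), h.norm_fderiv_radial_sub_le hδ x]
  have hclosed : IsClosed (Set.range (radial B)) := hanti.isClosed_range hlip.uniformContinuous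
  have hsurj : Function.Surjective (radial B) := Set.range_eq_univ.1 <|
    IsClopen.eq_univ ⟨hclosed, hopen.isOpen_range⟩ (Set.range_nonempty _)
  have hbij : Function.Bijective (radial B) := ⟨hanti.injective, hsurj⟩
  refine ⟨hbij, ?_⟩
  let e : E ≃ₜ E := (Equiv.ofBijective _ hbij).toHomeomorphOfContinuousOpen
    h.contDiff_radial.continuous hopen
  have he : Function.invFun (radial B) = e.symm := by
    funext y
    apply hbij.1
    rw [Function.invFun_eq (hsurj y)]
    exact (e.apply_symm_apply y).symm
  rw [he]
  exact e.contDiff_symm hD' h.contDiff_radial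

end Radial

/-- The composition `T (j-1) ∘ ⋯ ∘ T 0`. -/
noncomputable def clmProd {E : Type*} [NormedAddCommGroup E] [NormedSpace ℝ E] (T : ℕ → E →L[ℝ] E) :
    ℕ → E →L[ℝ] E
  | 0 => 1
  | j + 1 => T j * clmProd T j

section Products

variable {E : Type*} [NormedAddCommGroup E] [NormedSpace ℝ E] {T S : ℕ → E →L[ℝ] E}

theorem norm_clmProd_le {C : ℝ} {j : ℕ} (hT : ∀ l < j, ‖T l‖ ≤ C) :
    ‖clmProd T j‖ ≤ C ^ j := by
  induction j with
  | zero => rw [pow_zero]; exact ContinuousLinearMap.norm_id_le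
  | succ j ih =>
    have h0 : 0 ≤ C := (norm_nonneg _).trans (hT j j.lt_succ_self)
    rw [clmProd, pow_succ']
    exact (norm_mul_le _ _).trans <| mul_le_mul (hT j j.lt_succ_self)
      (ih fun l hl => hT l (hl.trans j.lt_succ_self)) (norm_nonneg _) h0

theorem norm_clmProd_sub_le {C η : ℝ} {j : ℕ} (hη : η ≤ 1) (hC : 0 ≤ C)
    (hS : ∀ l < j, ‖S l‖ ≤ C) (hTS : ∀ l < j, ‖T l - S l‖ ≤ η) :
    ‖clmProd T j - clmProd S j‖ ≤ j * η * (C + 1) ^ j := by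
  have hT : ∀ l < j, ‖T l‖ ≤ C + 1 := fun l hl => by
    have := norm_le_norm_add_norm_sub' (T l) (S l)
    linarith [hS l hl, hTS l hl]
  induction j with
  | zero => simp [clmProd]
  | succ j ih =>
    have hj := j.lt_succ_self
    have hη0 : 0 ≤ η := (norm_nonneg _).trans (hTS j hj)
    have ih' := ih (fun l hl => hS l (hl.trans hj)) (fun l hl => hTS l (hl.trans hj))
      (fun l hl => hT l (hl.trans hj))
    have hP : ‖clmProd T j‖ ≤ (C + 1) ^ j := norm_clmProd_le fun l hl => hT l (hl.trans hj)
    have hdec : clmProd T (j + 1) - clmProd S (j + 1)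
        = (T j - S j) * clmProd T j + S j * (clmProd T j - clmProd S j) := by
      simp only [clmProd]; noncomm_ring
    rw [hdec]
    calc _ ≤ ‖T j - S j‖ * ‖clmProd T j‖ + ‖S j‖ * ‖clmProd T j - clmProd S j‖ :=
          (norm_add_le _ _).trans (add_le_add (norm_mul_le _ _) (norm_mul_le _ _))
      _ ≤ η * (C + 1) ^ j + C * (j * η * (C + 1) ^ j) := by
          gcongr
          · exact hTS j hj
          · exact hS j hj
      _ ≤ η * (C + 1) ^ j * (C + 1) + C * (j * η * (C + 1) ^ j) + j * η * (C + 1) ^ j := by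
          have h1 : 0 ≤ η * (C + 1) ^ j := by positivity
          have h2 : 0 ≤ j * η * (C + 1) ^ j := by positivity
          nlinarith
      _ = _ := by push_cast; ring

end Products

theorem tendsto_zero_of_contraction_every {a : ℕ → ℝ} {K q : ℝ} {k : ℕ} (hk : 1 ≤ k)
    (hK : 1 ≤ K) (hq₀ : 0 ≤ q) (hq : q < 1) (ha : ∀ m, 0 ≤ a m) (h1 : ∀ m, a (m + 1) ≤ K * a m)
    (h2 : ∀ m, a (m + k) ≤ q * a m) : Tendsto a atTop (𝓝 0) := by
  have hr (r : ℕ) (m : ℕ) : a (m + r) ≤ K ^ r * a m := by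
    induction r with
    | zero => simp
    | succ r ih =>
      rw [pow_succ', mul_assoc]
      exact (h1 (m + r)).trans (by gcongr)
  have hd (d : ℕ) : a (k * d) ≤ q ^ d * a 0 := by
    induction d with
    | zero => simp
    | succ d ih =>
      rw [pow_succ', mul_assoc]
      exact (h2 (k * d)).trans (by gcongr)
  have hbound (m : ℕ) : a m ≤ K ^ k * (q ^ (m / k) * a 0) := by
    conv_lhs => rw [← Nat.div_add_mod m k]
    refine (hr _ _).trans ?_
    gcongr
    · exact ha _
    · exact (Nat.mod_lt _ hk).le
    · exact hd _
  refine squeeze_zero ha hbound ?_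
  have := ((tendsto_pow_atTop_nhds_zero_of_lt_one hq₀ hq).comp
    (Nat.tendsto_div_const_atTop (by omega : k ≠ 0))).mul_const (a 0) |>.const_mul (K ^ k)
  simpa using this

theorem step_iterate (n : ℕ) (f : ZMod n → E2 → E2) (p : E2 × ZMod n) (m : ℕ) :
    (step n f)^[m] p = (compUpTo n f p.2 m p.1, p.2 + m) := by
  induction m with
  | zero => simp [compUpTo]
  | succ m ih =>
    rw [Function.iterate_succ_apply', ih]
    simp [step, compUpTo, add_assoc]

theorem mCLM_partProd (n : ℕ) (A : ZMod n → M2) (i : ZMod n) (j : ℕ) :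
    mCLM (partProd n A i j) = clmProd (fun l => mCLM (A (i + l))) j := by
  induction j with
  | zero => simp [partProd, clmProd, mCLM]
  | succ j ih =>
    rw [clmProd, ← ih]
    simp [partProd, List.range_succ, mCLM]

section Cocycle

variable {n : ℕ} {K δ : ℝ} {B : ZMod n → ℝ → E2 →L[ℝ] E2}

theorem norm_compUpTo_le (hK : 0 ≤ K) (hB : ∀ i, IsSlowPath K δ (B i)) (i : ZMod n) (j : ℕ)
    (x : E2) : ‖compUpTo n (fun i => radial (B i)) i j x‖ ≤ K ^ j * ‖x‖ := by
  induction j with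
  | zero => simp [compUpTo]
  | succ j ih =>
    rw [pow_succ', mul_assoc]
    exact ((hB _).norm_radial_le _).trans (by gcongr)

theorem norm_le_mul_norm_compUpTo (hK : 0 ≤ K) (hB : ∀ i, IsSlowPath K δ (B i)) (i : ZMod n)
    (j : ℕ) (x : E2) : ‖x‖ ≤ K ^ j * ‖compUpTo n (fun i => radial (B i)) i j x‖ := by
  induction j with
  | zero => simp [compUpTo]
  | succ j ih =>
    rw [pow_succ, mul_assoc]
    exact ih.trans (by gcongr; exact (hB _).norm_le_mul_norm_radial _)

theorem norm_sub_along_orbit_le (hK : 1 ≤ K) (hδ : 0 ≤ δ) (hB : ∀ i, IsSlowPath K δ (B i))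
    (i i' : ZMod n) {j k : ℕ} (hjk : j ≤ k) (x : E2) :
    ‖B i' ‖compUpTo n (fun i => radial (B i)) i j x‖ - B i' ‖x‖‖ ≤ δ * K ^ k := by
  have hK0 : 0 ≤ K := by linarith
  have hpow : K ^ j ≤ K ^ k := pow_le_pow_right₀ hK hjk
  rcases eq_or_ne x 0 with rfl | hx
  · have : ‖compUpTo n (fun i => radial (B i)) i j 0‖ = 0 :=
      le_antisymm (by simpa using norm_compUpTo_le hK0 hB i j 0) (norm_nonneg _)
    simp only [this, norm_zero, sub_self]
    positivity
  · refine (hB i').norm_sub_le_of_comparable hδ (by positivity) (norm_pos_iff.2 hx) ?_ ?_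
    · exact (norm_compUpTo_le hK0 hB i j x).trans (by gcongr)
    · exact (norm_le_mul_norm_compUpTo hK0 hB i j x).trans (by gcongr)

theorem compUpTo_radial_eq (B : ZMod n → ℝ → E2 →L[ℝ] E2) (i : ZMod n) (j : ℕ) (x : E2) :
    compUpTo n (fun i => radial (B i)) i j x
      = clmProd (fun l => B (i + l) ‖compUpTo n (fun i => radial (B i)) i l x‖) j x := by
  induction j with
  | zero => simp [compUpTo, clmProd]
  | succ j ih =>
    rw [clmProd, mul_apply_eq_comp, ← ih]
    rfl

theorem hasFDerivAt_compUpTo (hB : ∀ i, IsSlowPath K δ (B i)) (i : ZMod n) (j : ℕ) (x : E2) :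
    HasFDerivAt (compUpTo n (fun i => radial (B i)) i j)
      (clmProd (fun l => fderiv ℝ (radial (B (i + l)))
        (compUpTo n (fun i => radial (B i)) i l x)) j) x := by
  induction j with
  | zero => exact hasFDerivAt_id x
  | succ j ih => exact ((hB _).hasFDerivAt_radial _).comp x ih

theorem norm_compUpTo_le_add (hK : 1 ≤ K) (hδ : 0 ≤ δ) (hB : ∀ i, IsSlowPath K δ (B i)) {k : ℕ}
    (hη : δ * K ^ k ≤ 1) (i : ZMod n) (x : E2) :
    ‖compUpTo n (fun i => radial (B i)) i k x‖
      ≤ (‖clmProd (fun l => B (i + l) ‖x‖) k‖ + k * (δ * K ^ k) * (K + 1) ^ k) * ‖x‖ := by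
  rw [compUpTo_radial_eq]
  refine ContinuousLinearMap.le_of_opNorm_le _ ?_ x
  refine (norm_le_norm_add_norm_sub' _ _).trans (add_le_add_right ?_ _)
  exact norm_clmProd_sub_le hη (by linarith) (fun l _ => (hB _).norm_le _ (norm_nonneg x))
    fun l hl => norm_sub_along_orbit_le hK hδ hB i _ hl.le x

theorem norm_fderiv_compUpTo_sub_le (hK : 1 ≤ K) (hδ : 0 ≤ δ) (hB : ∀ i, IsSlowPath K δ (B i))
    {j k : ℕ} (hjk : j ≤ k) (hη : 2 * (δ * K ^ k) ≤ 1) (i : ZMod n) (x : E2) :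
    ‖fderiv ℝ (compUpTo n (fun i => radial (B i)) i j) x - clmProd (fun l => B (i + l) ‖x‖) j‖
      ≤ k * (2 * (δ * K ^ k)) * (K + 1) ^ k := by
  rw [(hasFDerivAt_compUpTo hB i j x).fderiv]
  refine (norm_clmProd_sub_le hη (by linarith) (fun l _ => (hB _).norm_le _ (norm_nonneg x))
    fun l hl => ?_).trans ?_
  · have h1 := (hB (i + l)).norm_fderiv_radial_sub_le hδ
      (compUpTo n (fun i => radial (B i)) i l x)
    have h2 := norm_sub_along_orbit_le hK hδ hB i (i + l) (hl.le.trans hjk) x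
    have h3 : δ ≤ δ * K ^ k := le_mul_of_one_le_right hδ (one_le_pow₀ hK)
    have h4 := norm_sub_le_norm_sub_add_norm_sub (fderiv ℝ (radial (B (i + l)))
      (compUpTo n (fun i => radial (B i)) i l x))
      (B (i + l) ‖compUpTo n (fun i => radial (B i)) i l x‖) (B (i + l) ‖x‖)
    linarith
  · gcongr
    linarith

end Cocycle

attribute [local instance] Matrix.normedAddCommGroup Matrix.normedSpace

/-- `mCLM` as a continuous linear map. -/
noncomputable def mCLMHom : M2 →L[ℝ] E2 →L[ℝ] E2 :=
  LinearMap.toContinuousLinearMap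
    (Matrix.toEuclideanCLM (n := Fin 2) (𝕜 := ℝ)).toAlgEquiv.toLinearMap

theorem isSlowPath_mCLM {K δ : ℝ} {A : ℝ → M2} (hA : ContDiff ℝ 1 A)
    (hc : ∃ t₀ > 0, ∀ t ≤ t₀, A t = A 0)
    (hb : ∀ t, 0 ≤ t → IsUnit (A t) ∧ mnorm (A t) < K ∧ mnorm (Ring.inverse (A t)) < K)
    (hd : ∀ t, 0 < t → mnorm (deriv A t) ≤ δ / t) :
    IsSlowPath K δ fun t => mCLM (A t) where
  contDiff := mCLMHom.contDiff.comp hA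
  eventually_const := by
    obtain ⟨t₀, h₀, h⟩ := hc
    exact ⟨t₀, h₀, fun t ht => by rw [h t ht]⟩
  norm_le t ht := (hb t ht).2.1.le
  le_mul_norm t ht v := by
    have hinv : mCLM (Ring.inverse (A t)) (mCLM (A t) v) = v := by
      rw [← mul_apply_eq_comp, mCLM, mCLM, ← map_mul,
        Ring.inverse_mul_cancel _ (hb t ht).1, map_one, one_apply_eq_self]
    conv_lhs => rw [← hinv]
    exact ContinuousLinearMap.le_of_opNorm_le _ (hb t ht).2.2.le _
  norm_deriv_le t ht := by
    have h := mCLMHom.hasFDerivAt.comp_hasDerivAt t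
      (hA.differentiable one_ne_zero t).hasDerivAt
    have h' : deriv (fun t => mCLM (A t)) t = mCLM (deriv A t) := h.deriv
    rw [h']
    exact hd t ht

/-- Quantitative realization of slowly-varying paths of uniformly bounded,
uniformly contracting linear cocycles as contracting diffeomorphism cocycles, with control on
the derivatives of compositions of up to `k` consecutive maps. -/
theorem stmt1 (K : ℝ) (hK : 1 ≤ K) (ε : ℝ) (hε : 0 < ε) (k : ℕ) (hk : 1 ≤ k) :
    ∃ δ > 0, ∀ (n : ℕ), 1 ≤ n → ∀ A : ℝ → ZMod n → M2,
      (∀ i, ContDiff ℝ 1 fun t => A t i) →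
      (∃ t₀ > 0, ∀ t ≤ t₀, A t = A 0) →
      (∀ (i : ZMod n) (t : ℝ), 0 ≤ t →
        IsUnit (A t i) ∧ mnorm (A t i) < K ∧ mnorm (Ring.inverse (A t i)) < K) →
      (∀ (i : ZMod n) (t : ℝ), 0 ≤ t → mnorm (partProd n (A t) i k) < 1 / 2) →
      (∀ (i : ZMod n) (t : ℝ), 0 < t → mnorm (deriv (fun s => A s i) t) ≤ δ / t) →
      IsDiffeoCocycle n (fun i x => mact (A ‖x‖ i) x) ∧
      IsContractingCocycle n (fun i x => mact (A ‖x‖ i) x) ∧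
      ∀ (i : ZMod n) (x : E2) (j : ℕ), j ≤ k - 1 →
        ‖fderiv ℝ (compUpTo n (fun i' y => mact (A ‖y‖ i') y) i j) x
          - mCLM (partProd n (A ‖x‖) i j)‖ < ε := by
  have hK0 : 0 < K := by linarith
  have hk' : (1 : ℝ) ≤ k := by exact_mod_cast hk
  have hKk : K ≤ K ^ k := le_self_pow₀ hK (by omega)
  have hK1 : 1 ≤ (K + 1) ^ k := one_le_pow₀ (by linarith)
  set P : ℝ := k * (K + 1) ^ k with hP
  have hP1 : 1 ≤ P := one_le_mul_of_one_le_of_one_le hk' hK1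
  set δ : ℝ := min ε 1 / (4 * K ^ k * P) with hδdef
  have hmin : 0 < min ε 1 := lt_min hε one_pos
  have hδ : 0 < δ := by positivity
  have hδP : δ * K ^ k * P = min ε 1 / 4 := by
    rw [hδdef]; field_simp
  have hδk : δ * K ^ k ≤ 1 / 4 := by
    have h1 : δ * K ^ k ≤ δ * K ^ k * P := le_mul_of_one_le_right (by positivity) hP1
    linarith [min_le_right ε 1]
  have hKδ : K * δ < 1 := by nlinarith
  refine ⟨δ, hδ, fun n hn A hA hc hb hp hd => ?_⟩
  have hB : ∀ i, IsSlowPath K δ fun t => mCLM (A t i) := fun i =>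
    isSlowPath_mCLM (hA i)
      (hc.imp fun t₀ h => ⟨h.1, fun t ht => by rw [h.2 t ht]⟩) (hb i) (hd i)
  refine ⟨fun i => ⟨⟨(hB i).contDiff_radial,
    (hB i).bijective_radial_and_contDiff_invFun hδ.le hK0 hKδ⟩, map_zero _⟩, fun p => ?_,
    fun i x j hj => ?_⟩
  · rw [tendsto_zero_iff_norm_tendsto_zero]
    refine tendsto_zero_of_contraction_every (q := 3 / 4) hk hK (by norm_num) (by norm_num)
      (fun m => norm_nonneg _) (fun m => ?_) fun m => ?_
    · rw [Function.iterate_succ_apply']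
      exact (hB _).norm_radial_le _
    · rw [add_comm m k, Function.iterate_add_apply, step_iterate n _ _ k]
      set q := (step n fun i x => mact (A ‖x‖ i) x)^[m] p
      refine (norm_compUpTo_le_add hK hδ.le hB (by linarith) q.2 q.1).trans ?_
      gcongr
      have h1 := hp q.2 ‖q.1‖ (norm_nonneg _)
      rw [mnorm, mCLM_partProd] at h1
      have h2 : k * (δ * K ^ k) * (K + 1) ^ k = δ * K ^ k * P := by rw [hP]; ring
      linarith [min_le_right ε 1]
  · rw [mCLM_partProd]
    refine (norm_fderiv_compUpTo_sub_le hK hδ.le hB (hj.trans (k.sub_le 1)) (by linarith)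
      i x).trans_lt ?_
    have h2 : k * (2 * (δ * K ^ k)) * (K + 1) ^ k = 2 * (δ * K ^ k * P) := by rw [hP]; ring
    linarith [min_le_left ε 1]
end
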